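/- Let (f,g) be a control-affine system on an open set X ⊆ ℝ³ with g nowhere vanishing, and let ξ₀ ∈ X. Then (f,g) is locally feedback equivalent at ξ₀ to the elliptic system Σ_E = (f_E, g₀) at the origin if and only if there exist an open neighbourhood U ⊆ X of ξ₀ and smooth vector fields v₁, v₂, v₃ on U such that: (1) the set of infinitesimal symmetries of the restriction of (f,g) to U is exactly the real linear span of {v₁, v₂, v₃}; (2) v₁, v₂, v₃ are ℝ-linearly independent as vector fields; (3) [v₁,v₂] = 0, [v₁,v₃] = −v₂, and [v₂,v₃] = v₁ on U (so the symmetry algebra is isomorphic to 𝔏_E with abelian ideal I spanned by v₁, v₂); and (4) the vectors v₁(ξ₀), v₂(ξ₀), g(ξ₀) are linearly independent in ℝ³ (i.e., I(ξ₀) ⊕ ℝ·g(ξ₀) = ℝ³). -/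

import Mathlib

open Real Set

/-- The state space ℝ³ with coordinates (x, y, w). -/
abbrev V3 : Type := Fin 3 → ℝ

/-- Lie bracket of vector fields: [v,u](ξ) = Du(ξ)·v(ξ) − Dv(ξ)·u(ξ). -/
noncomputable def lieBr (v u : V3 → V3) : V3 → V3 :=
  fun ξ => fderiv ℝ u ξ (v ξ) - fderiv ℝ v ξ (u ξ)

/-- `v` is an infinitesimal symmetry of the control-affine system `(f, g)` on `U`. -/
def InfSymmOn (U : Set V3) (f g v : V3 → V3) : Prop :=
  ∀ ξ ∈ U, (∃ c : ℝ, lieBr v g ξ = c • g ξ) ∧ (∃ c : ℝ, lieBr v f ξ = c • g ξ)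

/-- The control vector field g₀ = ∂/∂w. -/
def g0 : V3 → V3 := fun _ => ![0, 0, 1]

/-- The systems `(f,g)` on `U` and `(f',g')` on `U'` are feedback equivalent via the
smooth diffeomorphism `φ : U → U'` and smooth feedback functions `α, β` with `β`
nowhere vanishing: Dφ(ξ)·(f(ξ)+α(ξ)g(ξ)) = f'(φ(ξ)) and Dφ(ξ)·(β(ξ)g(ξ)) = g'(φ(ξ)). -/
def FeedbackEquivOn (U U' : Set V3) (f g f' g' φ : V3 → V3) : Prop :=
  ContDiffOn ℝ (⊤ : ℕ∞) φ U ∧ φ '' U = U' ∧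
  (∃ ψ : V3 → V3, ContDiffOn ℝ (⊤ : ℕ∞) ψ U' ∧ (∀ ξ ∈ U, ψ (φ ξ) = ξ) ∧ (∀ η ∈ U', φ (ψ η) = η)) ∧
  ∃ α β : V3 → ℝ, ContDiffOn ℝ (⊤ : ℕ∞) α U ∧ ContDiffOn ℝ (⊤ : ℕ∞) β U ∧ (∀ ξ ∈ U, β ξ ≠ 0) ∧
    (∀ ξ ∈ U, fderiv ℝ φ ξ (f ξ + α ξ • g ξ) = f' (φ ξ)) ∧
    (∀ ξ ∈ U, fderiv ℝ φ ξ (β ξ • g ξ) = g' (φ ξ))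

/-- `(f,g)` on `X` is locally feedback equivalent at `ξ₀` to `(f',g')` at `ξ₀'`. -/
def LocFeedbackEquiv (X : Set V3) (f g : V3 → V3) (ξ₀ : V3)
    (f' g' : V3 → V3) (ξ₀' : V3) : Prop :=
  ∃ U U' : Set V3, IsOpen U ∧ IsOpen U' ∧ ξ₀ ∈ U ∧ U ⊆ X ∧ ξ₀' ∈ U' ∧
    ∃ φ : V3 → V3, φ ξ₀ = ξ₀' ∧ FeedbackEquivOn U U' f g f' g' φ

/-- The set of infinitesimal symmetries of `(f,g)` restricted to `U` is exactly the
real linear span of `{v₁, v₂, v₃}`: a smooth vector field on `U` is an infinitesimal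
symmetry iff it coincides on `U` with a real linear combination of v₁, v₂, v₃. -/
def SymmSpanned (U : Set V3) (f g v₁ v₂ v₃ : V3 → V3) : Prop :=
  ∀ v : V3 → V3, (ContDiffOn ℝ (⊤ : ℕ∞) v U ∧ InfSymmOn U f g v) ↔
    ∃ a b c : ℝ, ∀ ξ ∈ U, v ξ = a • v₁ ξ + b • v₂ ξ + c • v₃ ξ

/-- `v₁, v₂, v₃` are ℝ-linearly independent as vector fields on `U`. -/
def IndepFieldsOn (U : Set V3) (v₁ v₂ v₃ : V3 → V3) : Prop :=
  ∀ a b c : ℝ, (∀ ξ ∈ U, a • v₁ ξ + b • v₂ ξ + c • v₃ ξ = 0) → a = 0 ∧ b = 0 ∧ c = 0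

/-- Drift of the elliptic system Σ_E. -/
noncomputable def fE : V3 → V3 := fun ξ => ![Real.cos (ξ 2), Real.sin (ξ 2), 0]


open VectorField Filter Topology

lemma lieBr_eq_lieBracket (v u : V3 → V3) : lieBr v u = lieBracket ℝ v u := rfl

lemma lieBr_congr {U : Set V3} (hU : IsOpen U) {v v' u u' : V3 → V3}
    (hv : ∀ ξ ∈ U, v ξ = v' ξ) (hu : ∀ ξ ∈ U, u ξ = u' ξ) {ξ : V3} (hξ : ξ ∈ U) :
    lieBr v u ξ = lieBr v' u' ξ := by
  rw [lieBr_eq_lieBracket, lieBr_eq_lieBracket]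
  exact Filter.EventuallyEq.lieBracket_vectorField_eq
    (Filter.eventually_of_mem (hU.mem_nhds hξ) hv) (Filter.eventually_of_mem (hU.mem_nhds hξ) hu)

lemma smoothOn_diffAt {F : Type*} [NormedAddCommGroup F] [NormedSpace ℝ F]
    {U : Set V3} (hU : IsOpen U) {v : V3 → F}
    (hv : ContDiffOn ℝ (⊤ : ℕ∞) v U) {ξ : V3} (hξ : ξ ∈ U) : DifferentiableAt ℝ v ξ :=
  (hv.contDiffAt (hU.mem_nhds hξ)).differentiableAt (by simp)

/-- Feedback invariance of symmetries. -/
lemma InfSymmOn.feedback {U : Set V3} (hU : IsOpen U) {f g f' g' v : V3 → V3} {α β : V3 → ℝ}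
    (hf : ContDiffOn ℝ (⊤ : ℕ∞) f U) (hg : ContDiffOn ℝ (⊤ : ℕ∞) g U)
    (hα : ContDiffOn ℝ (⊤ : ℕ∞) α U) (hβ : ContDiffOn ℝ (⊤ : ℕ∞) β U)
    (hβ0 : ∀ ξ ∈ U, β ξ ≠ 0)
    (hf' : ∀ ξ ∈ U, f' ξ = f ξ + α ξ • g ξ) (hg' : ∀ ξ ∈ U, g' ξ = β ξ • g ξ)
    (h : InfSymmOn U f g v) : InfSymmOn U f' g' v := by
  intro ξ hξ
  obtain ⟨⟨c, hc⟩, ⟨d, hd⟩⟩ := h ξ hξ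
  have df := smoothOn_diffAt hU hf hξ
  have dg := smoothOn_diffAt hU hg hξ
  have da := smoothOn_diffAt hU hα hξ
  have db := smoothOn_diffAt hU hβ hξ
  have hb := hβ0 ξ hξ
  constructor
  · rw [lieBr_congr hU (fun _ _ => rfl) hg' hξ, lieBr_eq_lieBracket,
      lieBracket_smul_right db dg, ← lieBr_eq_lieBracket, hc, hg' ξ hξ]
    refine ⟨(fderiv ℝ β ξ (v ξ) + β ξ * c) / β ξ, ?_⟩
    rw [smul_smul, smul_smul, ← add_smul, div_mul_cancel₀ _ hb]
  · rw [lieBr_congr hU (u' := f + fun ξ => α ξ • g ξ) (fun _ _ => rfl) hf' hξ,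
      lieBr_eq_lieBracket, lieBracket_add_right (W₁ := fun ξ => α ξ • g ξ) df (da.fun_smul dg),
      lieBracket_smul_right da dg, ← lieBr_eq_lieBracket, ← lieBr_eq_lieBracket, hc, hd, hg' ξ hξ]
    refine ⟨(d + (fderiv ℝ α ξ (v ξ) + α ξ * c)) / β ξ, ?_⟩
    rw [smul_smul, smul_smul, ← add_smul, ← add_smul, div_mul_cancel₀ _ hb]

structure Diffeo3 (U U' : Set V3) (φ ψ : V3 → V3) : Prop where
  oU : IsOpen U
  oU' : IsOpen U'
  sφ : ContDiffOn ℝ (⊤ : ℕ∞) φ U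
  sψ : ContDiffOn ℝ (⊤ : ℕ∞) ψ U'
  mφ : ∀ ξ ∈ U, φ ξ ∈ U'
  mψ : ∀ η ∈ U', ψ η ∈ U
  li : ∀ ξ ∈ U, ψ (φ ξ) = ξ
  ri : ∀ η ∈ U', φ (ψ η) = η

lemma Diffeo3.symm {U U' : Set V3} {φ ψ : V3 → V3} (h : Diffeo3 U U' φ ψ) :
    Diffeo3 U' U ψ φ := ⟨h.oU', h.oU, h.sψ, h.sφ, h.mψ, h.mφ, h.ri, h.li⟩

/-- push forward of vector fields -/
noncomputable def push3 (φ ψ v : V3 → V3) : V3 → V3 := fun η => fderiv ℝ φ (ψ η) (v (ψ η))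

lemma Diffeo3.comp_fderiv {U U' : Set V3} {φ ψ : V3 → V3} (h : Diffeo3 U U' φ ψ)
    {η : V3} (hη : η ∈ U') :
    (fderiv ℝ φ (ψ η)).comp (fderiv ℝ ψ η) = ContinuousLinearMap.id ℝ V3 := by
  rw [← fderiv_comp η (smoothOn_diffAt h.oU h.sφ (h.mψ η hη)) (smoothOn_diffAt h.oU' h.sψ hη)]
  have : φ ∘ ψ =ᶠ[𝓝 η] id := Filter.eventually_of_mem (h.oU'.mem_nhds hη) h.ri
  rw [this.fderiv_eq, fderiv_id]

lemma Diffeo3.comp_fderiv' {U U' : Set V3} {φ ψ : V3 → V3} (h : Diffeo3 U U' φ ψ)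
    {η : V3} (hη : η ∈ U') :
    (fderiv ℝ ψ η).comp (fderiv ℝ φ (ψ η)) = ContinuousLinearMap.id ℝ V3 := by
  have := h.symm.comp_fderiv (h.mψ η hη)
  rwa [h.ri η hη] at this

lemma Diffeo3.push_eq {U U' : Set V3} {φ ψ : V3 → V3} (h : Diffeo3 U U' φ ψ) (v : V3 → V3)
    {η : V3} (hη : η ∈ U') : push3 φ ψ v η = pullback ℝ ψ v η := by
  unfold push3 pullback
  have hi : (fderiv ℝ ψ η).IsInvertible :=
    .of_inverse (h.comp_fderiv' hη) (h.comp_fderiv hη)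
  symm
  rw [hi.inverse_apply_eq]
  exact (congrArg (fun L => L (v (ψ η))) (h.comp_fderiv' hη)).symm

lemma Diffeo3.push_push {U U' : Set V3} {φ ψ : V3 → V3} (h : Diffeo3 U U' φ ψ) (v : V3 → V3)
    {ξ : V3} (hξ : ξ ∈ U) : push3 ψ φ (push3 φ ψ v) ξ = v ξ := by
  unfold push3
  rw [h.li ξ hξ]
  exact (congrArg (fun L => L (v ξ)) (h.symm.comp_fderiv hξ))

lemma Diffeo3.push_smooth {U U' : Set V3} {φ ψ : V3 → V3} (h : Diffeo3 U U' φ ψ) {v : V3 → V3}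
    (hv : ContDiffOn ℝ (⊤ : ℕ∞) v U) : ContDiffOn ℝ (⊤ : ℕ∞) (push3 φ ψ v) U' := by
  have h1 : ContDiffOn ℝ (⊤ : ℕ∞) (fderiv ℝ φ) U := h.sφ.fderiv_of_isOpen h.oU (by simp)
  exact ((h1.clm_apply hv).comp h.sψ h.mψ)

lemma Diffeo3.push_lieBr {U U' : Set V3} {φ ψ : V3 → V3} (h : Diffeo3 U U' φ ψ) {v u : V3 → V3}
    (hv : ContDiffOn ℝ (⊤ : ℕ∞) v U) (hu : ContDiffOn ℝ (⊤ : ℕ∞) u U) {η : V3} (hη : η ∈ U') :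
    lieBr (push3 φ ψ v) (push3 φ ψ u) η = push3 φ ψ (lieBr v u) η := by
  rw [h.push_eq _ hη, lieBr_congr h.oU' (fun _ => h.push_eq v) (fun _ => h.push_eq u) hη,
    lieBr_eq_lieBracket, lieBr_eq_lieBracket]
  symm
  exact pullback_lieBracket (n := ((⊤ : ℕ∞) : WithTop ℕ∞))
    (by simp only [minSmoothness_of_isRCLikeNormedField]; exact WithTop.coe_le_coe.2 (le_top (a := (2 : ℕ∞))))
    (h.sψ.contDiffAt (h.oU'.mem_nhds hη))
    (smoothOn_diffAt h.oU hv (h.mψ η hη)) (smoothOn_diffAt h.oU hu (h.mψ η hη))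

lemma Diffeo3.push_symm {U U' : Set V3} {φ ψ : V3 → V3} (h : Diffeo3 U U' φ ψ) {f g v : V3 → V3}
    (hf : ContDiffOn ℝ (⊤ : ℕ∞) f U) (hg : ContDiffOn ℝ (⊤ : ℕ∞) g U)
    (hv : ContDiffOn ℝ (⊤ : ℕ∞) v U) (hs : InfSymmOn U f g v) :
    InfSymmOn U' (push3 φ ψ f) (push3 φ ψ g) (push3 φ ψ v) := by
  intro η hη
  obtain ⟨⟨c, hc⟩, ⟨d, hd⟩⟩ := hs _ (h.mψ η hη)
  rw [h.push_lieBr hv hf hη, h.push_lieBr hv hg hη]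
  refine ⟨⟨c, ?_⟩, ⟨d, ?_⟩⟩
  · simp only [push3]; rw [hc, map_smul]
  · simp only [push3]; rw [hd, map_smul]

lemma InfSymmOn.congr {U : Set V3} (hU : IsOpen U) {f g v f' g' : V3 → V3}
    (hf : ∀ ξ ∈ U, f ξ = f' ξ) (hg : ∀ ξ ∈ U, g ξ = g' ξ)
    (h : InfSymmOn U f g v) : InfSymmOn U f' g' v := by
  intro ξ hξ
  rw [← lieBr_congr hU (fun _ _ => rfl) hf hξ, ← lieBr_congr hU (fun _ _ => rfl) hg hξ, ← hg ξ hξ]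
  exact h ξ hξ

/-- linear projection killing the `i`-th coordinate -/
noncomputable def killC (i : Fin 3) : V3 →L[ℝ] V3 :=
  ContinuousLinearMap.id ℝ V3 - (ContinuousLinearMap.proj (R := ℝ) (φ := fun _ : Fin 3 => ℝ) i).smulRight (Pi.single i (1 : ℝ))

lemma killC_apply (i : Fin 3) (ξ : V3) : killC i ξ = ξ - ξ i • Pi.single i (1 : ℝ) := rfl

lemma killC_apply_same (i : Fin 3) (ξ : V3) : killC i ξ i = 0 := by
  simp [killC_apply]

lemma killC_apply_ne {i j : Fin 3} (h : j ≠ i) (ξ : V3) : killC i ξ j = ξ j := by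
  simp [killC_apply, h]

lemma killC_mem {r : ℝ} (hr : 0 < r) (i : Fin 3) {ξ : V3} (h : ξ ∈ Metric.ball (0 : V3) r) :
    killC i ξ ∈ Metric.ball (0 : V3) r := by
  rw [mem_ball_zero_iff, pi_norm_lt_iff hr] at *
  intro j
  by_cases hj : j = i
  · subst hj; rw [killC_apply_same]; simpa using hr
  · rw [killC_apply_ne hj]; exact h j

lemma killC_eq {r : ℝ} (hr : 0 < r) (i : Fin 3) {F : V3 → ℝ}
    (hF : DifferentiableOn ℝ F (Metric.ball 0 r))
    (h0 : ∀ ξ ∈ Metric.ball (0 : V3) r, fderiv ℝ F ξ (Pi.single i 1) = 0)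
    {ξ : V3} (h : ξ ∈ Metric.ball (0 : V3) r) : F ξ = F (killC i ξ) := by
  obtain ⟨z, hz, he⟩ := domain_mvt (f := F) (f' := fderiv ℝ F) (s := Metric.ball 0 r)
    (fun x hx => ((hF x hx).differentiableAt
      (Metric.isOpen_ball.mem_nhds hx)).hasFDerivAt.hasFDerivWithinAt)
    (convex_ball _ _) (killC_mem hr i h) h
  have hz' : z ∈ Metric.ball (0 : V3) r :=
    (convex_ball (0 : V3) r).segment_subset (killC_mem hr i h) h hz
  have : ξ - killC i ξ = ξ i • Pi.single i (1 : ℝ) := by rw [killC_apply]; abel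
  rw [this, map_smul, h0 z hz', smul_zero] at he
  linarith

lemma killC_fderiv {r : ℝ} (hr : 0 < r) (i : Fin 3) {F : V3 → ℝ}
    (hF : DifferentiableOn ℝ F (Metric.ball 0 r))
    (h0 : ∀ ξ ∈ Metric.ball (0 : V3) r, fderiv ℝ F ξ (Pi.single i 1) = 0)
    {ξ : V3} (h : ξ ∈ Metric.ball (0 : V3) r) (u : V3) :
    fderiv ℝ F ξ u = fderiv ℝ F (killC i ξ) (killC i u) := by
  have h1 : F =ᶠ[𝓝 ξ] F ∘ (killC i) :=
    Filter.eventually_of_mem (Metric.isOpen_ball.mem_nhds h) (fun ζ hζ => killC_eq hr i hF h0 hζ)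
  rw [h1.fderiv_eq, fderiv_comp ξ ((hF _ (killC_mem hr i h)).differentiableAt
    (Metric.isOpen_ball.mem_nhds (killC_mem hr i h))) (killC i).differentiableAt,
    (killC i).fderiv]
  rfl

lemma killC_single {i j : Fin 3} (h : j ≠ i) :
    killC i (Pi.single j (1 : ℝ)) = Pi.single j (1 : ℝ) := by
  rw [killC_apply]; simp [h.symm]

lemma hasFDerivAt_fE (ξ : V3) (u : V3) :
    fderiv ℝ fE ξ u = ![- Real.sin (ξ 2) * u 2, Real.cos (ξ 2) * u 2, 0] := by
  have h : HasFDerivAt fE (ContinuousLinearMap.pi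
      ![(- Real.sin (ξ 2)) • (ContinuousLinearMap.proj (R := ℝ) (φ := fun _ : Fin 3 => ℝ) 2),
        (Real.cos (ξ 2)) • (ContinuousLinearMap.proj (R := ℝ) (φ := fun _ : Fin 3 => ℝ) 2), 0]) ξ := by
    rw [hasFDerivAt_pi']
    have hp : HasFDerivAt (fun ζ : V3 => ζ 2)
      (ContinuousLinearMap.proj (R := ℝ) (φ := fun _ : Fin 3 => ℝ) 2) ξ := hasFDerivAt_apply 2 ξ
    intro i
    fin_cases i
    · exact (Real.hasDerivAt_cos _).comp_hasFDerivAt ξ hp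
    · exact (Real.hasDerivAt_sin _).comp_hasFDerivAt ξ hp
    · exact hasFDerivAt_const (0 : ℝ) ξ
  rw [h.fderiv]
  ext i
  fin_cases i <;> simp

lemma fE_smooth : ContDiff ℝ (⊤ : ℕ∞) fE := by
  rw [contDiff_pi]
  intro i
  fin_cases i
  · exact Real.contDiff_cos.comp (contDiff_apply ℝ ℝ (2 : Fin 3))
  · exact Real.contDiff_sin.comp (contDiff_apply ℝ ℝ (2 : Fin 3))
  · exact contDiff_const

lemma fE_eq (ξ : V3) : fE ξ = Real.cos (ξ 2) • Pi.single 0 (1 : ℝ) + Real.sin (ξ 2) • Pi.single 1 (1 : ℝ) := by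
  ext i; fin_cases i <;> simp [fE]

lemma g0_eq (ξ : V3) : g0 ξ = Pi.single 2 (1 : ℝ) := by
  ext i; fin_cases i <;> simp [g0]

/-- the third symmetry of the elliptic system -/
def w3 : V3 → V3 := fun ξ => ![ξ 1, -ξ 0, -1]

lemma fderiv_comp3 {v : V3 → V3} {ξ : V3} (hv : DifferentiableAt ℝ v ξ) (i : Fin 3) (u : V3) :
    fderiv ℝ v ξ u i = fderiv ℝ (fun ζ => v ζ i) ξ u := by
  have := (hasFDerivAt_pi'.1 hv.hasFDerivAt i).fderiv
  rw [this]; rfl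

lemma fderiv_apply_eq {F : V3 → ℝ} {ξ : V3} (u : V3) :
    fderiv ℝ F ξ u = u 0 * fderiv ℝ F ξ (Pi.single 0 1) + u 1 * fderiv ℝ F ξ (Pi.single 1 1)
      + u 2 * fderiv ℝ F ξ (Pi.single 2 1) := by
  have : u = u 0 • Pi.single 0 1 + u 1 • Pi.single 1 1 + u 2 • Pi.single 2 1 := by
    ext i; fin_cases i <;> simp
  conv_lhs => rw [this]
  simp

lemma symm_elliptic {r : ℝ} (hr : 0 < r) (hr1 : r ≤ 1) {v : V3 → V3}
    (hv : ContDiffOn ℝ (⊤ : ℕ∞) v (Metric.ball 0 r))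
    (hs : InfSymmOn (Metric.ball 0 r) fE g0 v) :
    ∃ a b c : ℝ, ∀ ξ ∈ Metric.ball (0 : V3) r,
      v ξ = a • Pi.single 0 (1 : ℝ) + b • Pi.single 1 (1 : ℝ) + c • w3 ξ := by
  set B := Metric.ball (0 : V3) r with hB
  have hBo : IsOpen B := Metric.isOpen_ball
  have hdv : ∀ ξ ∈ B, DifferentiableAt ℝ v ξ := fun ξ h => smoothOn_diffAt hBo hv h
  set a : V3 → ℝ := fun ζ => v ζ 0 with ha
  set b : V3 → ℝ := fun ζ => v ζ 1 with hb
  have hda : ∀ ξ ∈ B, DifferentiableAt ℝ a ξ := fun ξ h => differentiableAt_pi.1 (hdv ξ h) 0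
  have hdb : ∀ ξ ∈ B, DifferentiableAt ℝ b ξ := fun ξ h => differentiableAt_pi.1 (hdv ξ h) 1
  have hoa : DifferentiableOn ℝ a B := fun ξ h => (hda ξ h).differentiableWithinAt
  have hob : DifferentiableOn ℝ b B := fun ξ h => (hdb ξ h).differentiableWithinAt
  have hw : ∀ ξ ∈ B, fderiv ℝ a ξ (Pi.single 2 1) = 0 ∧ fderiv ℝ b ξ (Pi.single 2 1) = 0 := by
    intro ξ hξ
    obtain ⟨⟨c, hc⟩, -⟩ := hs ξ hξ
    have h1 : fderiv ℝ g0 ξ = 0 := by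
      have : g0 = fun _ => ![0, 0, 1] := rfl
      rw [this]; simp
    unfold lieBr at hc
    rw [h1, g0_eq] at hc
    have e0 := congrFun hc 0
    have e1 := congrFun hc 1
    simp [fderiv_comp3 (hdv ξ hξ)] at e0 e1
    exact ⟨e0, e1⟩
  have hf : ∀ ξ ∈ B,
      -Real.sin (ξ 2) * v ξ 2 = Real.cos (ξ 2) * fderiv ℝ a ξ (Pi.single 0 1)
        + Real.sin (ξ 2) * fderiv ℝ a ξ (Pi.single 1 1) ∧
      Real.cos (ξ 2) * v ξ 2 = Real.cos (ξ 2) * fderiv ℝ b ξ (Pi.single 0 1)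
        + Real.sin (ξ 2) * fderiv ℝ b ξ (Pi.single 1 1) := by
    intro ξ hξ
    obtain ⟨-, ⟨c, hc⟩⟩ := hs ξ hξ
    unfold lieBr at hc
    rw [hasFDerivAt_fE, fE_eq, g0_eq] at hc
    have e0 := congrFun hc 0
    have e1 := congrFun hc 1
    simp [fderiv_comp3 (hdv ξ hξ)] at e0 e1
    constructor
    · linear_combination e0
    · linear_combination e1
  have hk : ∀ ξ ∈ B, killC 2 ξ ∈ B := fun ξ h => killC_mem hr 2 h
  have n02 : (0 : Fin 3) ≠ 2 := by decide
  have n12 : (1 : Fin 3) ≠ 2 := by decide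
  -- Killing equations at points with w = 0
  have key : ∀ ξ ∈ B, fderiv ℝ a ξ (Pi.single 0 1) = 0 ∧ fderiv ℝ b ξ (Pi.single 1 1) = 0 ∧
      fderiv ℝ a ξ (Pi.single 1 1) = - fderiv ℝ b ξ (Pi.single 0 1) := by
    intro ξ hξ
    have red : ∀ w : ℝ, |w| < r → Function.update ξ 2 w ∈ B ∧
        killC 2 (Function.update ξ 2 w) = killC 2 ξ := by
      intro w hw'
      constructor
      · rw [hB, mem_ball_zero_iff, pi_norm_lt_iff hr] at *
        intro j
        by_cases hj : j = 2
        · subst hj; simpa using hw'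
        · simpa [hj] using hξ j
      · ext j
        by_cases hj : j = 2
        · subst hj; rw [killC_apply_same, killC_apply_same]
        · rw [killC_apply_ne hj, killC_apply_ne hj]; simp [hj]
    have red2 : ∀ w : ℝ, |w| < r →
        0 = Real.cos w ^ 2 * fderiv ℝ a (killC 2 ξ) (Pi.single 0 1)
          + Real.sin w * Real.cos w * (fderiv ℝ a (killC 2 ξ) (Pi.single 1 1)
            + fderiv ℝ b (killC 2 ξ) (Pi.single 0 1))
          + Real.sin w ^ 2 * fderiv ℝ b (killC 2 ξ) (Pi.single 1 1) := by
      intro w hw'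
      obtain ⟨m, e⟩ := red w hw'
      obtain ⟨f1, f2⟩ := hf _ m
      rw [killC_fderiv hr 2 hoa (fun ζ h => (hw ζ h).1) m, killC_fderiv hr 2 hoa (fun ζ h => (hw ζ h).1) m, killC_single n02, killC_single n12, e] at f1
      rw [killC_fderiv hr 2 hob (fun ζ h => (hw ζ h).2) m, killC_fderiv hr 2 hob (fun ζ h => (hw ζ h).2) m, killC_single n02, killC_single n12, e] at f2
      simp only [Function.update_self] at f1 f2
      linear_combination Real.cos w * f1 + Real.sin w * f2
    rw [killC_fderiv hr 2 hoa (fun ζ h => (hw ζ h).1) hξ,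
      killC_fderiv hr 2 hoa (fun ζ h => (hw ζ h).1) hξ,
      killC_fderiv hr 2 hob (fun ζ h => (hw ζ h).2) hξ,
      killC_fderiv hr 2 hob (fun ζ h => (hw ζ h).2) hξ, killC_single n02, killC_single n12]
    have A0 := red2 0 (by simpa using hr)
    have A1 := red2 (r/2) (by rw [abs_of_pos] <;> linarith)
    have A2 := red2 (-(r/2)) (by rw [abs_neg, abs_of_pos] <;> linarith)
    simp at A0
    have hsin : 0 < Real.sin (r/2) := Real.sin_pos_of_pos_of_lt_pi (by linarith) (by linarith [Real.pi_gt_three])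
    have hcos : 0 < Real.cos (r/2) := Real.cos_pos_of_mem_Ioo ⟨by linarith [Real.pi_gt_three], by linarith [Real.pi_gt_three]⟩
    rw [← A0] at A1 A2 ⊢
    rw [Real.sin_neg, Real.cos_neg] at A2
    refine ⟨rfl, ?_, ?_⟩
    · have : Real.sin (r/2) ^ 2 * fderiv ℝ b (killC 2 ξ) (Pi.single 1 1) = 0 := by
        linear_combination -(A1 + A2)/2
      rcases mul_eq_zero.1 this with h | h
      · exact absurd h (by positivity)
      · exact h
    · have : Real.sin (r/2) * Real.cos (r/2) * (fderiv ℝ a (killC 2 ξ) (Pi.single 1 1)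
            + fderiv ℝ b (killC 2 ξ) (Pi.single 0 1)) = 0 := by
        linear_combination -(A1 - A2)/2
      rcases mul_eq_zero.1 this with h | h
      · exact absurd h (by positivity)
      · linarith
  have kc : killC 1 (killC 2 (killC 0 (0 : V3))) = 0 := by simp
  have hay : ∀ ξ ∈ B, fderiv ℝ a ξ (Pi.single 1 1) = fderiv ℝ a 0 (Pi.single 1 1) := by
    intro ξ hξ
    have m0 := killC_mem hr 0 hξ
    have m2 := killC_mem hr 2 m0
    have m1 := killC_mem hr 1 m2
    have e : killC 1 (killC 2 (killC 0 ξ)) = 0 := by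
      ext j; fin_cases j <;> simp [killC_apply]
    rw [killC_fderiv hr 0 hoa (fun ζ h => (key ζ h).1) hξ, killC_single (by decide),
      killC_fderiv hr 2 hoa (fun ζ h => (hw ζ h).1) m0, killC_single (by decide),
      (key _ m2).2.2, killC_fderiv hr 1 hob (fun ζ h => (key ζ h).2.1) m2, killC_single (by decide), e,
      (key 0 (by simpa [hB] using hr)).2.2]
  set k := fderiv ℝ a 0 (Pi.single 1 1) with hkdef
  have pc : IsPreconnected B := (convex_ball _ _).isPreconnected
  obtain ⟨a0, ha0⟩ := hBo.exists_eq_add_of_fderiv_eq pc hoa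
    (g := fun ζ => k * ζ 1) (fun ξ _ => by fun_prop) (by
      intro ξ hξ
      ext u
      have : fderiv ℝ (fun ζ : V3 => k * ζ 1) ξ = k • ContinuousLinearMap.proj (R := ℝ) (φ := fun _ : Fin 3 => ℝ) 1 :=
        ((hasFDerivAt_apply (𝕜 := ℝ) (1 : Fin 3) ξ).const_mul k).fderiv
      rw [this, fderiv_apply_eq, (key ξ hξ).1, hay ξ hξ, (hw ξ hξ).1]
      simp [mul_comm])
  obtain ⟨b0, hb0⟩ := hBo.exists_eq_add_of_fderiv_eq pc hob
    (g := fun ζ => (-k) * ζ 0) (fun ξ _ => by fun_prop) (by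
      intro ξ hξ
      ext u
      have : fderiv ℝ (fun ζ : V3 => (-k) * ζ 0) ξ = (-k) • ContinuousLinearMap.proj (R := ℝ) (φ := fun _ : Fin 3 => ℝ) 0 :=
        ((hasFDerivAt_apply (𝕜 := ℝ) (0 : Fin 3) ξ).const_mul (-k)).fderiv
      have h2 := (key ξ hξ).2.2
      rw [hay ξ hξ] at h2
      rw [this, fderiv_apply_eq, (key ξ hξ).2.1, (hw ξ hξ).2]
      simp only [_root_.smul_apply, ContinuousLinearMap.proj_apply, smul_eq_mul]
      rw [h2]; ring)
  refine ⟨a0, b0, k, fun ξ hξ => ?_⟩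
  have h0 := ha0 hξ
  have h1 := hb0 hξ
  simp only [Pi.add_apply] at h0 h1
  have h2 := (hf ξ hξ).2
  have h3 := (key ξ hξ).2.2
  rw [hay ξ hξ] at h3
  rw [(key ξ hξ).2.1] at h2
  have hξ2 : |ξ 2| < r := by
    rw [hB, mem_ball_zero_iff, pi_norm_lt_iff hr] at hξ
    exact hξ 2
  have hcos : 0 < Real.cos (ξ 2) := by
    rw [abs_lt] at hξ2
    exact Real.cos_pos_of_mem_Ioo ⟨by linarith [Real.pi_gt_three], by linarith [Real.pi_gt_three]⟩
  have h4 : v ξ 2 = -k := by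
    apply mul_left_cancel₀ hcos.ne'
    rw [h2, h3]; ring
  ext i
  fin_cases i
  · simp [w3]; simp only [ha] at h0; linarith
  · simp [w3]; simp only [hb] at h1; linarith
  · simp [w3]; linarith

lemma linIndep3_iff {x y z : V3} : LinearIndependent ℝ ![x, y, z] ↔
    ∀ a b c : ℝ, a • x + b • y + c • z = 0 → a = 0 ∧ b = 0 ∧ c = 0 := by
  rw [Fintype.linearIndependent_iff]
  constructor
  · intro h a b c habc
    have := h ![a, b, c] (by simpa [Fin.sum_univ_three] using habc)
    exact ⟨this 0, this 1, this 2⟩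
  · intro h c hc i
    have := h (c 0) (c 1) (c 2) (by simpa [Fin.sum_univ_three] using hc)
    fin_cases i
    · exact this.1
    · exact this.2.1
    · exact this.2.2

lemma w3_smooth : ContDiff ℝ (⊤ : ℕ∞) w3 := by
  rw [contDiff_pi]
  intro i
  fin_cases i
  · exact contDiff_apply ℝ ℝ (1 : Fin 3)
  · exact (contDiff_apply ℝ ℝ (0 : Fin 3)).neg
  · exact contDiff_const

lemma fderiv_w3 (ξ u : V3) : fderiv ℝ w3 ξ u = ![u 1, - u 0, 0] := by
  have hd : DifferentiableAt ℝ w3 ξ := w3_smooth.contDiffAt.differentiableAt (by simp)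
  have p : ∀ i : Fin 3, HasFDerivAt (fun ζ : V3 => ζ i)
      (ContinuousLinearMap.proj (R := ℝ) (φ := fun _ : Fin 3 => ℝ) i) ξ :=
    fun i => hasFDerivAt_apply i ξ
  ext i
  rw [fderiv_comp3 hd]
  fin_cases i
  · have : (fun ζ : V3 => w3 ζ 0) = fun ζ => ζ 1 := rfl
    simp [this, (p 1).fderiv]
  · have : (fun ζ : V3 => w3 ζ 1) = fun ζ => - ζ 0 := rfl
    simp [this, (p 0).fun_neg.fderiv]
  · have : (fun ζ : V3 => w3 ζ 2) = fun ζ => -1 := rfl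
    simp [this]

noncomputable def w1 : V3 → V3 := fun _ => Pi.single 0 (1 : ℝ)
noncomputable def w2 : V3 → V3 := fun _ => Pi.single 1 (1 : ℝ)

lemma w1_smooth : ContDiff ℝ (⊤ : ℕ∞) w1 := contDiff_const
lemma w2_smooth : ContDiff ℝ (⊤ : ℕ∞) w2 := contDiff_const

lemma fderiv_w1 (ξ : V3) : fderiv ℝ w1 ξ = 0 := by unfold w1; simp
lemma fderiv_w2 (ξ : V3) : fderiv ℝ w2 ξ = 0 := by unfold w2; simp
lemma fderiv_g0 (ξ : V3) : fderiv ℝ g0 ξ = 0 := by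
  have : g0 = fun _ => ![0, 0, 1] := rfl
  rw [this]; simp
lemma g0_smooth : ContDiff ℝ (⊤ : ℕ∞) g0 := contDiff_const

lemma elliptic_symm (a b c : ℝ) (U : Set V3) :
    InfSymmOn U fE g0 (fun ξ => a • w1 ξ + b • w2 ξ + c • w3 ξ) := by
  have d1 : ∀ ξ, DifferentiableAt ℝ w1 ξ := fun ξ => w1_smooth.contDiffAt.differentiableAt (by simp)
  have d2 : ∀ ξ, DifferentiableAt ℝ w2 ξ := fun ξ => w2_smooth.contDiffAt.differentiableAt (by simp)
  have d3 : ∀ ξ, DifferentiableAt ℝ w3 ξ := fun ξ => w3_smooth.contDiffAt.differentiableAt (by simp)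
  have hd : ∀ ξ u, fderiv ℝ (fun ξ => a • w1 ξ + b • w2 ξ + c • w3 ξ) ξ u
      = c • ![u 1, - u 0, 0] := by
    intro ξ u
    rw [fderiv_fun_add (((d1 ξ).fun_const_smul a).fun_add ((d2 ξ).fun_const_smul b)) ((d3 ξ).fun_const_smul c),
      fderiv_fun_add ((d1 ξ).fun_const_smul a) ((d2 ξ).fun_const_smul b), fderiv_fun_const_smul (d1 ξ),
      fderiv_fun_const_smul (d2 ξ), fderiv_fun_const_smul (d3 ξ), fderiv_w1, fderiv_w2]
    simp [fderiv_w3]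
  intro ξ _
  constructor
  · refine ⟨0, ?_⟩
    unfold lieBr
    rw [hd, fderiv_g0]
    ext i; fin_cases i <;> simp [g0]
  · refine ⟨0, ?_⟩
    unfold lieBr
    rw [hd, hasFDerivAt_fE]
    ext i; fin_cases i <;> simp [fE, w1, w2, w3] <;> ring

lemma elliptic_br (ξ : V3) : lieBr w1 w2 ξ = 0 ∧ lieBr w1 w3 ξ = -(w2 ξ) ∧ lieBr w2 w3 ξ = w1 ξ := by
  unfold lieBr
  rw [fderiv_w1, fderiv_w2, fderiv_w3, fderiv_w3]
  refine ⟨by simp, ?_, ?_⟩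
  · ext i; fin_cases i <;> simp [w1, w2]
  · ext i; fin_cases i <;> simp [w1, w2]

lemma elliptic_forward (X : Set V3) (f g : V3 → V3)
    (hf : ContDiffOn ℝ (⊤ : ℕ∞) f X) (hg : ContDiffOn ℝ (⊤ : ℕ∞) g X)
    (ξ₀ : V3) (h : LocFeedbackEquiv X f g ξ₀ fE g0 0) :
      ∃ U : Set V3, IsOpen U ∧ ξ₀ ∈ U ∧ U ⊆ X ∧
        ∃ v₁ v₂ v₃ : V3 → V3,
          ContDiffOn ℝ (⊤ : ℕ∞) v₁ U ∧ ContDiffOn ℝ (⊤ : ℕ∞) v₂ U ∧ ContDiffOn ℝ (⊤ : ℕ∞) v₃ U ∧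
          SymmSpanned U f g v₁ v₂ v₃ ∧
          IndepFieldsOn U v₁ v₂ v₃ ∧
          (∀ ξ ∈ U, lieBr v₁ v₂ ξ = 0 ∧ lieBr v₁ v₃ ξ = -(v₂ ξ) ∧ lieBr v₂ v₃ ξ = v₁ ξ) ∧
          LinearIndependent ℝ ![v₁ ξ₀, v₂ ξ₀, g ξ₀] := by
  obtain ⟨U₁, U₁', oU₁, oU₁', m0, sub, m0', φ, φ0, sφ, im, ⟨ψ, sψ, li, ri⟩, α, β, sα, sβ, β0, ef, eg⟩ := h
  obtain ⟨r', hr', hb'⟩ := Metric.isOpen_iff.1 oU₁' 0 m0'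
  set r := min r' 1 with hrdef
  have hr : 0 < r := lt_min hr' one_pos
  have hr1 : r ≤ 1 := min_le_right _ _
  set B := Metric.ball (0 : V3) r with hB
  have hBU : B ⊆ U₁' := (Metric.ball_subset_ball (min_le_left _ _)).trans hb'
  set U := U₁ ∩ φ ⁻¹' B with hU
  have oU : IsOpen U := sφ.continuousOn.isOpen_inter_preimage oU₁ Metric.isOpen_ball
  have hUU : U ⊆ U₁ := inter_subset_left
  have D : Diffeo3 U B φ ψ := by
    refine ⟨oU, Metric.isOpen_ball, sφ.mono hUU, sψ.mono hBU, fun ξ h => h.2, ?_,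
      fun ξ h => li ξ h.1, fun η h => ri η (hBU h)⟩
    intro η hη
    refine ⟨?_, ?_⟩
    · have := hBU hη
      rw [← im] at this
      obtain ⟨ξ, hξ, rfl⟩ := this
      rw [li ξ hξ]; exact hξ
    · rw [mem_preimage, ri η (hBU hη)]; exact hη
  have hξU : ξ₀ ∈ U := ⟨m0, by rw [mem_preimage, φ0]; exact Metric.mem_ball_self hr⟩
  have hfU := hf.mono (hUU.trans sub)
  have hgU := hg.mono (hUU.trans sub)
  have hαU := sα.mono hUU
  have hβU := sβ.mono hUU
  have ef' : ∀ η ∈ B, push3 φ ψ (fun ξ => f ξ + α ξ • g ξ) η = fE η := by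
    intro η hη
    have := ef _ (hUU (D.mψ η hη))
    rw [D.ri η hη] at this
    exact this
  have eg' : ∀ η ∈ B, push3 φ ψ (fun ξ => β ξ • g ξ) η = g0 η := by
    intro η hη
    have := eg _ (hUU (D.mψ η hη))
    rw [D.ri η hη] at this
    exact this
  have ef2 : ∀ ξ ∈ U, push3 ψ φ fE ξ = f ξ + α ξ • g ξ := by
    intro ξ hξ
    rw [← D.push_push (fun ξ => f ξ + α ξ • g ξ) hξ]
    simp only [push3]
    exact congrArg _ (ef' _ (D.mφ ξ hξ)).symm
  have eg2 : ∀ ξ ∈ U, push3 ψ φ g0 ξ = β ξ • g ξ := by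
    intro ξ hξ
    rw [← D.push_push (fun ξ => β ξ • g ξ) hξ]
    simp only [push3]
    exact congrArg _ (eg' _ (D.mφ ξ hξ)).symm
  have lin : ∀ (a b c : ℝ) (ξ : V3), push3 ψ φ (fun ξ => a • w1 ξ + b • w2 ξ + c • w3 ξ) ξ
      = a • push3 ψ φ w1 ξ + b • push3 ψ φ w2 ξ + c • push3 ψ φ w3 ξ := by
    intro a b c ξ
    simp [push3]
  have sm1 := D.symm.push_smooth (w1_smooth.contDiffOn (s := B))
  have sm2 := D.symm.push_smooth (w2_smooth.contDiffOn (s := B))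
  have sm3 := D.symm.push_smooth (w3_smooth.contDiffOn (s := B))
  refine ⟨U, oU, hξU, hUU.trans sub, push3 ψ φ w1, push3 ψ φ w2, push3 ψ φ w3,
    sm1, sm2, sm3, ?_, ?_, ?_, ?_⟩
  · intro v
    constructor
    · rintro ⟨sv, hsym⟩
      have h1 : InfSymmOn U (fun ξ => f ξ + α ξ • g ξ) (fun ξ => β ξ • g ξ) v :=
        hsym.feedback oU hfU hgU hαU hβU (fun ξ h => β0 ξ (hUU h)) (fun _ _ => rfl) (fun _ _ => rfl)
      have h2 := D.push_symm (hfU.add (hαU.smul hgU)) (hβU.smul hgU) sv h1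
      have h3 := h2.congr Metric.isOpen_ball ef' eg'
      obtain ⟨a, b, c, habc⟩ := symm_elliptic hr hr1 (D.push_smooth sv) h3
      refine ⟨a, b, c, fun ξ hξ => ?_⟩
      rw [← lin, ← D.push_push v hξ]
      exact congrArg (fderiv ℝ ψ (φ ξ)) (habc _ (D.mφ ξ hξ))
    · rintro ⟨a, b, c, habc⟩
      have sv : ContDiffOn ℝ (⊤ : ℕ∞) v U :=
        (((sm1.const_smul a).add (sm2.const_smul b)).add (sm3.const_smul c)).congr habc
      refine ⟨sv, ?_⟩
      have h1 := D.symm.push_symm fE_smooth.contDiffOn g0_smooth.contDiffOn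
        (v := fun ξ => a • w1 ξ + b • w2 ξ + c • w3 ξ)
        (((w1_smooth.const_smul a).add (w2_smooth.const_smul b)).add
          (w3_smooth.const_smul c)).contDiffOn (elliptic_symm a b c B)
      have h2 := h1.congr oU ef2 eg2
      have h3 : InfSymmOn U (fun ξ => f ξ + α ξ • g ξ) (fun ξ => β ξ • g ξ) v := by
        intro ξ hξ
        have := h2 ξ hξ
        have hvv : ∀ ζ ∈ U, v ζ = push3 ψ φ (fun ξ => a • w1 ξ + b • w2 ξ + c • w3 ξ) ζ := by
          intro ζ hζ; rw [lin, habc ζ hζ]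
        rw [lieBr_congr oU hvv (fun _ _ => rfl) hξ, lieBr_congr oU hvv (fun _ _ => rfl) hξ]
        exact this
      have hb0 : ∀ ξ ∈ U, β ξ ≠ 0 := fun ξ h => β0 ξ (hUU h)
      refine h3.feedback (α := fun ξ => - (α ξ / β ξ)) (β := fun ξ => (β ξ)⁻¹) oU
        (hfU.add (hαU.smul hgU)) (hβU.smul hgU) ((hαU.div hβU hb0).neg) (hβU.inv hb0)
        (fun ξ h => inv_ne_zero (hb0 ξ h)) ?_ ?_
      · intro ξ hξ
        have := hb0 ξ hξ
        change _ = f ξ + α ξ • g ξ + (-(α ξ / β ξ)) • (β ξ • g ξ)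
        rw [smul_smul, neg_mul, div_mul_cancel₀ _ this, neg_smul]; abel
      · intro ξ hξ
        have := hb0 ξ hξ
        change _ = (β ξ)⁻¹ • (β ξ • g ξ)
        rw [smul_smul, inv_mul_cancel₀ this, one_smul]
  · intro a b c habc
    have := habc ξ₀ hξU
    rw [← lin] at this
    have h2 := D.symm.push_push (fun ξ => a • w1 ξ + b • w2 ξ + c • w3 ξ) (D.mφ _ hξU)
    unfold push3 at h2 this
    rw [D.li _ hξU, this] at h2
    have e0 := congrFun h2 0
    have e1 := congrFun h2 1
    have e2 := congrFun h2 2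
    simp [w1, w2, w3, φ0] at e0 e1 e2
    refine ⟨e0.symm, e1.symm, e2⟩
  · intro ξ hξ
    obtain ⟨h1, h2, h3⟩ := elliptic_br (φ ξ)
    rw [D.symm.push_lieBr w1_smooth.contDiffOn w2_smooth.contDiffOn hξ,
      D.symm.push_lieBr w1_smooth.contDiffOn w3_smooth.contDiffOn hξ,
      D.symm.push_lieBr w2_smooth.contDiffOn w3_smooth.contDiffOn hξ]
    unfold push3
    rw [h1, h2, h3]
    simp
  · rw [linIndep3_iff]
    intro a b c habc
    have q1 := D.symm.push_push w1 (D.mφ _ hξU)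
    have q2 := D.symm.push_push w2 (D.mφ _ hξU)
    have q3 := eg ξ₀ m0
    simp only [push3, D.li _ hξU] at q1 q2
    have h := congrArg (fderiv ℝ φ ξ₀) habc
    have hb := β0 ξ₀ m0
    simp only [push3, map_add, map_smul, map_zero, q1, q2] at h
    rw [map_smul] at q3
    have q4 : fderiv ℝ φ ξ₀ (g ξ₀) = (β ξ₀)⁻¹ • g0 (φ ξ₀) := by
      rw [← q3, smul_smul, inv_mul_cancel₀ hb, one_smul]
    rw [q4] at h
    have e0 := congrFun h 0
    have e1 := congrFun h 1
    have e2 := congrFun h 2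
    simp [w1, w2, g0, hb] at e0 e1 e2
    exact ⟨e0, e1, e2⟩

/-! ### Backward direction -/

noncomputable def frameA (v₁ v₂ g : V3 → V3) (ξ : V3) : V3 →L[ℝ] V3 :=
  (ContinuousLinearMap.proj (R := ℝ) (φ := fun _ : Fin 3 => ℝ) 0).smulRight (v₁ ξ)
  + (ContinuousLinearMap.proj (R := ℝ) (φ := fun _ : Fin 3 => ℝ) 1).smulRight (v₂ ξ)
  + (ContinuousLinearMap.proj (R := ℝ) (φ := fun _ : Fin 3 => ℝ) 2).smulRight (g ξ)

lemma frameA_apply (v₁ v₂ g : V3 → V3) (ξ e : V3) :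
    frameA v₁ v₂ g ξ e = e 0 • v₁ ξ + e 1 • v₂ ξ + e 2 • g ξ := rfl

lemma frame_exists {U : Set V3} (hU : IsOpen U) {v₁ v₂ g : V3 → V3}
    (h1 : ContDiffOn ℝ (⊤ : ℕ∞) v₁ U) (h2 : ContDiffOn ℝ (⊤ : ℕ∞) v₂ U)
    (hg : ContDiffOn ℝ (⊤ : ℕ∞) g U) {ξ₀ : V3} (hξ₀ : ξ₀ ∈ U)
    (hLI : LinearIndependent ℝ ![v₁ ξ₀, v₂ ξ₀, g ξ₀]) :
    ∃ r > 0, Metric.ball ξ₀ r ⊆ U ∧ ∃ θ₀ θ₁ θ₂ : V3 → (V3 →L[ℝ] ℝ),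
      ContDiffOn ℝ (⊤ : ℕ∞) θ₀ (Metric.ball ξ₀ r) ∧ ContDiffOn ℝ (⊤ : ℕ∞) θ₁ (Metric.ball ξ₀ r) ∧
      ContDiffOn ℝ (⊤ : ℕ∞) θ₂ (Metric.ball ξ₀ r) ∧
      ∀ ξ ∈ Metric.ball ξ₀ r,
        (θ₀ ξ (v₁ ξ) = 1 ∧ θ₀ ξ (v₂ ξ) = 0 ∧ θ₀ ξ (g ξ) = 0) ∧
        (θ₁ ξ (v₁ ξ) = 0 ∧ θ₁ ξ (v₂ ξ) = 1 ∧ θ₁ ξ (g ξ) = 0) ∧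
        (θ₂ ξ (v₁ ξ) = 0 ∧ θ₂ ξ (v₂ ξ) = 0 ∧ θ₂ ξ (g ξ) = 1) ∧
        ∀ u, u = θ₀ ξ u • v₁ ξ + θ₁ ξ u • v₂ ξ + θ₂ ξ u • g ξ := by
  have hA : ContDiffOn ℝ (⊤ : ℕ∞) (frameA v₁ v₂ g) U := by
    unfold frameA
    exact ((contDiffOn_const.smulRight h1).add (contDiffOn_const.smulRight h2)).add
      (contDiffOn_const.smulRight hg)
  have hinj : Function.Injective (frameA v₁ v₂ g ξ₀).toLinearMap := by
    rw [← LinearMap.ker_eq_bot, LinearMap.ker_eq_bot']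
    intro e he
    have := linIndep3_iff.1 hLI (e 0) (e 1) (e 2) he
    ext i; fin_cases i <;> simp [this]
  obtain ⟨E0, hE0⟩ : ∃ E0 : V3 ≃L[ℝ] V3, (E0 : V3 →L[ℝ] V3) = frameA v₁ v₂ g ξ₀ :=
    ⟨(LinearEquiv.ofInjectiveEndo _ hinj).toContinuousLinearEquiv, by ext; rfl⟩
  have hev : ∀ᶠ ξ in 𝓝 ξ₀, ξ ∈ U ∧ frameA v₁ v₂ g ξ ∈ range ((↑) : (V3 ≃L[ℝ] V3) → (V3 →L[ℝ] V3)) := by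
    refine (hU.eventually_mem hξ₀).and ?_
    have hc : ContinuousAt (frameA v₁ v₂ g) ξ₀ := (hA.contDiffAt (hU.mem_nhds hξ₀)).continuousAt
    apply hc
    rw [← hE0]
    exact ContinuousLinearEquiv.nhds E0
  obtain ⟨r, hr, hB⟩ := Metric.eventually_nhds_iff_ball.1 hev
  have hL : ContDiffOn ℝ (⊤ : ℕ∞) (fun ξ => (frameA v₁ v₂ g ξ).inverse) (Metric.ball ξ₀ r) := by
    intro ξ hξ
    obtain ⟨hξU, e, he⟩ := hB ξ hξ
    have := contDiffAt_map_inverse (𝕜 := ℝ) (n := (⊤ : ℕ∞)) e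
    rw [he] at this
    exact (this.comp ξ (hA.contDiffAt (hU.mem_nhds hξU))).contDiffWithinAt
  refine ⟨r, hr, fun ξ hξ => (hB ξ hξ).1,
    fun ξ => (ContinuousLinearMap.proj 0).comp (frameA v₁ v₂ g ξ).inverse,
    fun ξ => (ContinuousLinearMap.proj 1).comp (frameA v₁ v₂ g ξ).inverse,
    fun ξ => (ContinuousLinearMap.proj 2).comp (frameA v₁ v₂ g ξ).inverse,
    contDiffOn_const.clm_comp hL, contDiffOn_const.clm_comp hL, contDiffOn_const.clm_comp hL, ?_⟩
  intro ξ hξ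
  obtain ⟨hξU, e, he⟩ := hB ξ hξ
  have i1 : (frameA v₁ v₂ g ξ).inverse (v₁ ξ) = ![1, 0, 0] := by
    rw [← he, ContinuousLinearMap.inverse_equiv]
    apply e.injective
    have := frameA_apply v₁ v₂ g ξ ![1, 0, 0]
    rw [← he] at this; simpa using this.symm
  have i2 : (frameA v₁ v₂ g ξ).inverse (v₂ ξ) = ![0, 1, 0] := by
    rw [← he, ContinuousLinearMap.inverse_equiv]
    apply e.injective
    have := frameA_apply v₁ v₂ g ξ ![0, 1, 0]
    rw [← he] at this; simpa using this.symm
  have i3 : (frameA v₁ v₂ g ξ).inverse (g ξ) = ![0, 0, 1] := by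
    rw [← he, ContinuousLinearMap.inverse_equiv]
    apply e.injective
    have := frameA_apply v₁ v₂ g ξ ![0, 0, 1]
    rw [← he] at this; simpa using this.symm
  simp only [ContinuousLinearMap.comp_apply, i1, i2, i3, ContinuousLinearMap.proj_apply]
  refine ⟨by simp, by simp, by simp, fun u => ?_⟩
  rw [← frameA_apply, ← he, ContinuousLinearMap.inverse_equiv]
  simp

lemma form_cartan {θ : V3 → (V3 →L[ℝ] ℝ)} {u u' : V3 → V3} {ξ : V3}
    (hθ : DifferentiableAt ℝ θ ξ) (hu : DifferentiableAt ℝ u ξ) (hu' : DifferentiableAt ℝ u' ξ) :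
    fderiv ℝ θ ξ (u ξ) (u' ξ) - fderiv ℝ θ ξ (u' ξ) (u ξ) =
      fderiv ℝ (fun ζ => θ ζ (u' ζ)) ξ (u ξ) - fderiv ℝ (fun ζ => θ ζ (u ζ)) ξ (u' ξ)
        - θ ξ (lieBr u u' ξ) := by
  rw [fderiv_clm_apply hθ hu', fderiv_clm_apply hθ hu]
  simp [lieBr]
  ring

lemma fderiv_const_on {B : Set V3} (hB : IsOpen B) {F : V3 → ℝ} {k : ℝ} (h : ∀ ξ ∈ B, F ξ = k)
    {ξ : V3} (hξ : ξ ∈ B) : fderiv ℝ F ξ = 0 := by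
  have : F =ᶠ[𝓝 ξ] fun _ => k := Filter.eventually_of_mem (hB.mem_nhds hξ) h
  rw [this.fderiv_eq]; simp

lemma form_closed {B : Set V3} (hB : IsOpen B) {θ θ₀ θ₁ θ₂ : V3 → (V3 →L[ℝ] ℝ)} {v₁ v₂ g : V3 → V3}
    {k₁ k₂ : ℝ}
    (hθ : ContDiffOn ℝ (⊤ : ℕ∞) θ B)
    (h1 : ContDiffOn ℝ (⊤ : ℕ∞) v₁ B) (h2 : ContDiffOn ℝ (⊤ : ℕ∞) v₂ B)
    (hg : ContDiffOn ℝ (⊤ : ℕ∞) g B)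
    (e1 : ∀ ξ ∈ B, θ ξ (v₁ ξ) = k₁) (e2 : ∀ ξ ∈ B, θ ξ (v₂ ξ) = k₂) (eg : ∀ ξ ∈ B, θ ξ (g ξ) = 0)
    (hu : ∀ ξ ∈ B, ∀ u, u = θ₀ ξ u • v₁ ξ + θ₁ ξ u • v₂ ξ + θ₂ ξ u • g ξ)
    (b12 : ∀ ξ ∈ B, lieBr v₁ v₂ ξ = 0)
    (b1g : ∀ ξ ∈ B, ∃ c : ℝ, lieBr v₁ g ξ = c • g ξ)
    (b2g : ∀ ξ ∈ B, ∃ c : ℝ, lieBr v₂ g ξ = c • g ξ) :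
    ∀ ξ ∈ B, ∀ x y, fderiv ℝ θ ξ x y = fderiv ℝ θ ξ y x := by
  intro ξ hξ x y
  have dθ := smoothOn_diffAt hB hθ hξ
  have d1 := smoothOn_diffAt hB h1 hξ
  have d2 := smoothOn_diffAt hB h2 hξ
  have dg := smoothOn_diffAt hB hg hξ
  have c12 := form_cartan dθ d1 d2
  have c1g := form_cartan dθ d1 dg
  have c2g := form_cartan dθ d2 dg
  obtain ⟨c, hc⟩ := b1g ξ hξ
  obtain ⟨d, hd⟩ := b2g ξ hξ
  rw [fderiv_const_on hB e1 hξ, fderiv_const_on hB e2 hξ, b12 ξ hξ] at c12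
  rw [fderiv_const_on hB e1 hξ, fderiv_const_on hB eg hξ, hc, map_smul, eg ξ hξ] at c1g
  rw [fderiv_const_on hB e2 hξ, fderiv_const_on hB eg hξ, hd, map_smul, eg ξ hξ] at c2g
  simp at c12 c1g c2g
  rw [hu ξ hξ x, hu ξ hξ y]
  simp
  linear_combination (θ₀ ξ x * θ₁ ξ y - θ₁ ξ x * θ₀ ξ y) * c12 +
    (θ₀ ξ x * θ₂ ξ y - θ₂ ξ x * θ₀ ξ y) * c1g + (θ₁ ξ x * θ₂ ξ y - θ₂ ξ x * θ₁ ξ y) * c2g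

lemma primitive_smooth {B : Set V3} (hB : IsOpen B) (hc : Convex ℝ B) {θ : V3 → (V3 →L[ℝ] ℝ)}
    (hθ : ContDiffOn ℝ (⊤ : ℕ∞) θ B)
    (hcl : ∀ ξ ∈ B, ∀ x y, fderiv ℝ θ ξ x y = fderiv ℝ θ ξ y x) (ξ₀ : V3) :
    ∃ F : V3 → ℝ, F ξ₀ = 0 ∧ ContDiffOn ℝ (⊤ : ℕ∞) F B ∧ ∀ ξ ∈ B, HasFDerivAt F (θ ξ) ξ := by
  obtain ⟨F, hF⟩ := hc.exists_forall_hasFDerivAt_of_fderiv_symmetric hB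
    (fun ξ hξ => (smoothOn_diffAt hB hθ hξ).differentiableWithinAt) hcl
  refine ⟨fun ξ => F ξ - F ξ₀, by simp, ?_, fun ξ hξ => (hF ξ hξ).sub_const _⟩
  refine ContDiffOn.sub ?_ contDiffOn_const
  rw [contDiffOn_infty_iff_fderiv_of_isOpen hB]
  refine ⟨fun ξ hξ => (hF ξ hξ).differentiableAt.differentiableWithinAt, ?_⟩
  exact hθ.congr fun ξ hξ => (hF ξ hξ).fderiv

lemma form_drift {B : Set V3} (hB : IsOpen B) {θ θ₀ θ₁ θ₂ : V3 → (V3 →L[ℝ] ℝ)}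
    {v₁ v₂ v₃ f g : V3 → V3} {k₁ k₂ : ℝ}
    (hθ : ContDiffOn ℝ (⊤ : ℕ∞) θ B)
    (h1 : ContDiffOn ℝ (⊤ : ℕ∞) v₁ B) (h2 : ContDiffOn ℝ (⊤ : ℕ∞) v₂ B)
    (h3 : ContDiffOn ℝ (⊤ : ℕ∞) v₃ B)
    (hf : ContDiffOn ℝ (⊤ : ℕ∞) f B) (hg : ContDiffOn ℝ (⊤ : ℕ∞) g B)
    (e1 : ∀ ξ ∈ B, θ ξ (v₁ ξ) = k₁) (e2 : ∀ ξ ∈ B, θ ξ (v₂ ξ) = k₂) (eg : ∀ ξ ∈ B, θ ξ (g ξ) = 0)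
    (hu : ∀ ξ ∈ B, ∀ u, u = θ₀ ξ u • v₁ ξ + θ₁ ξ u • v₂ ξ + θ₂ ξ u • g ξ)
    (hcl : ∀ ξ ∈ B, ∀ x y, fderiv ℝ θ ξ x y = fderiv ℝ θ ξ y x)
    (b13 : ∀ ξ ∈ B, lieBr v₁ v₃ ξ = -(v₂ ξ)) (b23 : ∀ ξ ∈ B, lieBr v₂ v₃ ξ = v₁ ξ)
    (s1 : InfSymmOn B f g v₁) (s2 : InfSymmOn B f g v₂) (s3 : InfSymmOn B f g v₃)
    {ξ : V3} (hξ : ξ ∈ B) :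
    fderiv ℝ (fun ζ => θ ζ (f ζ)) ξ (v₁ ξ) = 0 ∧ fderiv ℝ (fun ζ => θ ζ (f ζ)) ξ (v₂ ξ) = 0 ∧
    θ₂ ξ (v₃ ξ) * fderiv ℝ (fun ζ => θ ζ (f ζ)) ξ (g ξ) =
      θ₁ ξ (f ξ) * k₁ - θ₀ ξ (f ξ) * k₂ := by
  have dθ := smoothOn_diffAt hB hθ hξ
  have d1 := smoothOn_diffAt hB h1 hξ
  have d2 := smoothOn_diffAt hB h2 hξ
  have d3 := smoothOn_diffAt hB h3 hξ
  have dg := smoothOn_diffAt hB hg hξ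
  have df := smoothOn_diffAt hB hf hξ
  have c1f := form_cartan dθ d1 df
  have c2f := form_cartan dθ d2 df
  have c3f := form_cartan dθ d3 df
  have c13 := form_cartan dθ d1 d3
  have c23 := form_cartan dθ d2 d3
  have c3g := form_cartan dθ d3 dg
  rw [hcl ξ hξ, sub_self] at c1f c2f c3f c13 c23 c3g
  obtain ⟨c1, hc1⟩ := (s1 ξ hξ).2
  obtain ⟨c2, hc2⟩ := (s2 ξ hξ).2
  obtain ⟨c3, hc3⟩ := (s3 ξ hξ).2
  obtain ⟨c4, hc4⟩ := (s3 ξ hξ).1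
  rw [fderiv_const_on hB e1 hξ, hc1, map_smul, eg ξ hξ] at c1f
  rw [fderiv_const_on hB e2 hξ, hc2, map_smul, eg ξ hξ] at c2f
  rw [hc3, map_smul, eg ξ hξ] at c3f
  rw [fderiv_const_on hB e1 hξ, b13 ξ hξ, map_neg, e2 ξ hξ] at c13
  rw [fderiv_const_on hB e2 hξ, b23 ξ hξ, e1 ξ hξ] at c23
  rw [fderiv_const_on hB eg hξ, hc4, map_smul, eg ξ hξ] at c3g
  simp only [smul_eq_mul, mul_zero, sub_zero, zero_apply] at c1f c2f c3f c13 c23 c3g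
  refine ⟨c1f.symm, c2f.symm, ?_⟩
  generalize fderiv ℝ (fun ζ => θ ζ (f ζ)) ξ = P at *
  generalize fderiv ℝ (fun ζ => θ ζ (v₃ ζ)) ξ = Q at *
  have hP : P (v₃ ξ) = θ₂ ξ (v₃ ξ) * P (g ξ) := by
    conv_lhs => rw [hu ξ hξ (v₃ ξ)]
    simp only [map_add, map_smul, smul_eq_mul, ← c1f, ← c2f]; ring
  have hQ : Q (f ξ) = θ₀ ξ (f ξ) * Q (v₁ ξ) + θ₁ ξ (f ξ) * Q (v₂ ξ) + θ₂ ξ (f ξ) * Q (g ξ) := by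
    conv_lhs => rw [hu ξ hξ (f ξ)]
    simp only [map_add, map_smul, smul_eq_mul]
  linear_combination (-1) * hP - c3f + hQ - θ₀ ξ (f ξ) * c13 - θ₁ ξ (f ξ) * c23 + θ₂ ξ (f ξ) * c3g

/-- If the drift were parallel to `g` near `ξ₀`, the symmetry algebra would be too big. -/
lemma drift_not_parallel {U B : Set V3} (hU : IsOpen U) (hB : IsOpen B) (hBU : B ⊆ U)
    {f g v₁ v₂ v₃ : V3 → V3} {h : V3 → ℝ} {ξ₀ : V3} (hξ₀ : ξ₀ ∈ B)
    (hg : ContDiffOn ℝ (⊤ : ℕ∞) g U)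
    (h1 : ContDiffOn ℝ (⊤ : ℕ∞) v₁ U) (h2 : ContDiffOn ℝ (⊤ : ℕ∞) v₂ U)
    (h3 : ContDiffOn ℝ (⊤ : ℕ∞) v₃ U)
    (hh : ContDiffOn ℝ (⊤ : ℕ∞) h B) (hfh : ∀ ξ ∈ B, f ξ = h ξ • g ξ)
    (hs : SymmSpanned U f g v₁ v₂ v₃) (s1 : InfSymmOn U f g v₁)
    (hbr : ∀ ξ ∈ U, lieBr v₁ v₂ ξ = 0 ∧ lieBr v₁ v₃ ξ = -(v₂ ξ) ∧ lieBr v₂ v₃ ξ = v₁ ξ)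
    (hLI : LinearIndependent ℝ ![v₁ ξ₀, v₂ ξ₀, g ξ₀]) : False := by
  obtain ⟨χ, hχB, -, hχ, -, hχ1⟩ :=
    exists_contDiff_tsupport_subset (n := (⊤ : ℕ∞)) (hB.mem_nhds hξ₀)
  have hsm : ContDiffOn ℝ (⊤ : ℕ∞) (fun ξ => χ ξ • g ξ) U := hχ.contDiffOn.smul hg
  have hsym : InfSymmOn U f g (fun ξ => χ ξ • g ξ) := by
    intro ξ hξ
    have dχ : DifferentiableAt ℝ χ ξ := (hχ.differentiable (by simp)) ξ
    have dg := smoothOn_diffAt hU hg hξ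
    have key : ∃ c : ℝ, lieBr (fun ξ => χ ξ • g ξ) g ξ = c • g ξ := by
      rw [lieBr_eq_lieBracket, lieBracket_smul_left dχ dg]
      refine ⟨-(fderiv ℝ χ ξ) (g ξ), ?_⟩
      simp
    refine ⟨key, ?_⟩
    by_cases hB' : ξ ∈ B
    · obtain ⟨c, hc⟩ := key
      have dh := smoothOn_diffAt hB hh hB'
      rw [lieBr_congr hB (u' := fun ξ => h ξ • g ξ) (fun _ _ => rfl) hfh hB',
        lieBr_eq_lieBracket, lieBracket_smul_right dh dg, ← lieBr_eq_lieBracket, hc]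
      refine ⟨fderiv ℝ h ξ (χ ξ • g ξ) + h ξ * c, ?_⟩
      rw [add_smul, smul_smul]
    · have hO : IsOpen (tsupport χ)ᶜ := (isClosed_tsupport χ).isOpen_compl
      have hm : ξ ∈ (tsupport χ)ᶜ := fun hx => hB' (hχB hx)
      rw [lieBr_congr hO (v' := fun _ => 0) (u' := f)
        (fun ζ hζ => by simp [image_eq_zero_of_notMem_tsupport hζ]) (fun _ _ => rfl) hm]
      exact ⟨0, by simp [lieBr]⟩
  obtain ⟨a, b, c, habc⟩ := (hs _).1 ⟨hsm, hsym⟩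
  have hξU := hBU hξ₀
  have dχ : DifferentiableAt ℝ χ ξ₀ := (hχ.differentiable (by simp)) ξ₀
  have dg := smoothOn_diffAt hU hg hξU
  have d1 := smoothOn_diffAt hU h1 hξU
  have d2 := smoothOn_diffAt hU h2 hξU
  have d3 := smoothOn_diffAt hU h3 hξU
  obtain ⟨k, hk⟩ := (s1 ξ₀ hξU).1
  have e1 := lieBracket_smul_right (V := v₁) dχ dg
  rw [← lieBr_eq_lieBracket, ← lieBr_eq_lieBracket, hk,
    lieBr_congr hU (u' := (a • v₁ + b • v₂) + c • v₃) (fun _ _ => rfl) habc hξU,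
    lieBr_eq_lieBracket, lieBracket_add_right ((d1.const_smul a).add (d2.const_smul b))
      (d3.const_smul c), lieBracket_add_right (d1.const_smul a) (d2.const_smul b),
    lieBracket_const_smul_right d1, lieBracket_const_smul_right d2,
    lieBracket_const_smul_right d3, ← lieBr_eq_lieBracket, ← lieBr_eq_lieBracket,
    ← lieBr_eq_lieBracket, (hbr ξ₀ hξU).1, (hbr ξ₀ hξU).2.1] at e1
  have z : lieBr v₁ v₁ ξ₀ = 0 := by simp [lieBr]
  rw [z] at e1
  have hc0 := (linIndep3_iff.1 hLI 0 c (fderiv ℝ χ ξ₀ (v₁ ξ₀) + χ ξ₀ * k) (by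
    rw [add_smul, mul_smul, ← e1]; simp)).2.1
  have e2 := habc ξ₀ hξU
  simp only [hc0, hχ1] at e2
  have := (linIndep3_iff.1 hLI a b (-1) (by
    simp at e2; rw [e2]; module)).2.2
  norm_num at this

lemma chart_final {X B : Set V3} (hB : IsOpen B) (hBX : B ⊆ X) {f g : V3 → V3}
    {x y P Q c r : V3 → ℝ} {ξ₀ : V3} (hξ₀ : ξ₀ ∈ B)
    (hx : ContDiffOn ℝ (⊤ : ℕ∞) x B) (hy : ContDiffOn ℝ (⊤ : ℕ∞) y B)
    (hP : ContDiffOn ℝ (⊤ : ℕ∞) P B) (hQ : ContDiffOn ℝ (⊤ : ℕ∞) Q B)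
    (hc : ContDiffOn ℝ (⊤ : ℕ∞) c B) (hr : ContDiffOn ℝ (⊤ : ℕ∞) r B)
    (hx0 : x ξ₀ = 0) (hy0 : y ξ₀ = 0) (hP0 : P ξ₀ = 1) (hQ0 : Q ξ₀ = 0)
    (hPQ : ∀ ξ ∈ B, P ξ ^ 2 + Q ξ ^ 2 = 1)
    (hxf : ∀ ξ ∈ B, fderiv ℝ x ξ (f ξ) = P ξ) (hxg : ∀ ξ ∈ B, fderiv ℝ x ξ (g ξ) = 0)
    (hyf : ∀ ξ ∈ B, fderiv ℝ y ξ (f ξ) = Q ξ) (hyg : ∀ ξ ∈ B, fderiv ℝ y ξ (g ξ) = 0)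
    (hQf : ∀ ξ ∈ B, fderiv ℝ Q ξ (f ξ) = r ξ * fderiv ℝ Q ξ (g ξ))
    (hQg : ∀ ξ ∈ B, c ξ * fderiv ℝ Q ξ (g ξ) = - P ξ)
    (hker : ∀ ξ ∈ B, ∀ u, fderiv ℝ x ξ u = 0 → fderiv ℝ y ξ u = 0 → ∃ k : ℝ, u = k • g ξ) :
    LocFeedbackEquiv X f g ξ₀ fE g0 0 := by
  set W : Set V3 := B ∩ P ⁻¹' (Ioi 0) with hWdef
  have hW : IsOpen W := hP.continuousOn.isOpen_inter_preimage hB isOpen_Ioi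
  have hξW : ξ₀ ∈ W := ⟨hξ₀, by simp [hP0]⟩
  have hQ1 : ∀ ξ ∈ W, Q ξ ≠ -1 ∧ Q ξ ≠ 1 ∧ -1 ≤ Q ξ ∧ Q ξ ≤ 1 ∧ √(1 - Q ξ ^ 2) = P ξ := by
    intro ξ hξ
    have h1 := hPQ ξ hξ.1
    have h2 : 0 < P ξ := hξ.2
    have h3 : 0 < P ξ ^ 2 := by positivity
    refine ⟨fun h => ?_, fun h => ?_, by nlinarith, by nlinarith, ?_⟩
    · rw [h] at h1; linarith
    · rw [h] at h1; linarith
    · rw [← h1, add_sub_cancel_right, Real.sqrt_sq h2.le]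
  set w : V3 → ℝ := fun ξ => Real.arcsin (Q ξ) with hwdef
  have hw : ContDiffOn ℝ (⊤ : ℕ∞) w W := fun ξ hξ =>
    ((Real.contDiffAt_arcsin (hQ1 ξ hξ).1 (hQ1 ξ hξ).2.1).comp ξ
      (hQ.contDiffAt (hB.mem_nhds hξ.1))).contDiffWithinAt
  have dw : ∀ ξ ∈ W, ∀ u, fderiv ℝ w ξ u = fderiv ℝ Q ξ u / P ξ := by
    intro ξ hξ u
    have h1 := (Real.hasDerivAt_arcsin (hQ1 ξ hξ).1 (hQ1 ξ hξ).2.1).comp_hasFDerivAt ξ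
      (smoothOn_diffAt hB hQ hξ.1).hasFDerivAt
    have h2 : fderiv ℝ w ξ = _ := h1.fderiv
    rw [h2, (hQ1 ξ hξ).2.2.2.2]
    simp; ring
  set φ : V3 → V3 := fun ξ => ![x ξ, y ξ, w ξ] with hφdef
  have hWB : W ⊆ B := fun _ h => h.1
  have hφ : ContDiffOn ℝ (⊤ : ℕ∞) φ W := by
    rw [contDiffOn_pi]
    intro i; fin_cases i
    · exact hx.mono hWB
    · exact hy.mono hWB
    · exact hw
  have dφ : ∀ ξ ∈ W, ∀ u, fderiv ℝ φ ξ u =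
      ![fderiv ℝ x ξ u, fderiv ℝ y ξ u, fderiv ℝ Q ξ u / P ξ] := by
    intro ξ hξ u
    have hd := smoothOn_diffAt hW hφ hξ
    ext i; rw [fderiv_comp3 hd, ← dw ξ hξ u]
    fin_cases i <;> rfl
  have hne : ∀ ξ ∈ W, c ξ ≠ 0 ∧ fderiv ℝ Q ξ (g ξ) ≠ 0 := by
    intro ξ hξ
    have h1 := hQg ξ hξ.1
    have h2 : 0 < P ξ := hξ.2
    constructor <;> intro h <;> rw [h] at h1 <;> simp at h1 <;> linarith
  have hinv : ∀ ξ ∈ W, ∃ e : V3 ≃L[ℝ] V3, (e : V3 →L[ℝ] V3) = fderiv ℝ φ ξ := by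
    intro ξ hξ
    have hinj : Function.Injective (fderiv ℝ φ ξ).toLinearMap := by
      rw [← LinearMap.ker_eq_bot, LinearMap.ker_eq_bot']
      intro u hu
      have hu' : fderiv ℝ φ ξ u = 0 := hu
      rw [dφ ξ hξ] at hu'
      have u0 := congrFun hu' 0
      have u1 := congrFun hu' 1
      have u2 := congrFun hu' 2
      have hp : P ξ ≠ 0 := ne_of_gt hξ.2
      simp at u0 u1 u2
      obtain ⟨k, hk⟩ := hker ξ hξ.1 u u0 u1
      rw [hk, map_smul, smul_eq_mul] at u2
      have : k = 0 := by simpa [hp, (hne ξ hξ).2] using u2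
      rw [hk, this, zero_smul]
    exact ⟨(LinearEquiv.ofInjectiveEndo _ hinj).toContinuousLinearEquiv, by ext; rfl⟩
  have hder : ∀ ξ ∈ W, HasFDerivAt φ (fderiv ℝ φ ξ) ξ :=
    fun ξ hξ => (smoothOn_diffAt hW hφ hξ).hasFDerivAt
  have hca : ∀ ξ ∈ W, ContDiffAt ℝ (⊤ : ℕ∞) φ ξ := fun ξ hξ => hφ.contDiffAt (hW.mem_nhds hξ)
  obtain ⟨e0, he0⟩ := hinv ξ₀ hξW
  obtain ⟨h, hh, hsrc⟩ : ∃ h : OpenPartialHomeomorph V3 V3, (h : V3 → V3) = φ ∧ ξ₀ ∈ h.source :=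
    ⟨(hca ξ₀ hξW).toOpenPartialHomeomorph φ (f' := e0) (he0 ▸ hder ξ₀ hξW) (by simp), rfl,
      ContDiffAt.mem_toOpenPartialHomeomorph_source _ _ _⟩
  have hVo : IsOpen (h.source ∩ W) := h.open_source.inter hW
  have hφ0 : φ ξ₀ = 0 := by
    ext i; fin_cases i <;> simp [φ, hx0, hy0, w, hQ0]
  refine ⟨h.source ∩ W, φ '' (h.source ∩ W), hVo, ?_, ⟨hsrc, hξW⟩,
    fun ξ hξ => hBX hξ.2.1, ⟨ξ₀, ⟨hsrc, hξW⟩, hφ0⟩, φ, hφ0,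
    hφ.mono inter_subset_right, rfl, ⟨h.symm, ?_, ?_, ?_⟩, fun ξ => - r ξ, fun ξ => - c ξ,
    (hr.mono fun ξ hξ => hξ.2.1).neg, (hc.mono fun ξ hξ => hξ.2.1).neg, ?_, ?_, ?_⟩
  · rw [← hh]; exact h.isOpen_image_of_subset_source hVo inter_subset_left
  · rintro _ ⟨ξ, hξ, rfl⟩
    obtain ⟨e, he⟩ := hinv ξ hξ.2
    have hl : h.symm (φ ξ) = ξ := by rw [← hh]; exact h.left_inv hξ.1
    refine (h.contDiffAt_symm (f₀' := e) ?_ ?_ ?_).contDiffWithinAt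
    · rw [← hh]; exact h.map_source hξ.1
    · rw [hl, he, hh]; exact hder ξ hξ.2
    · rw [hl, hh]; exact hca ξ hξ.2
  · intro ξ hξ; rw [← hh]; exact h.left_inv hξ.1
  · rintro _ ⟨ξ, hξ, rfl⟩
    have hl : h.symm (φ ξ) = ξ := by rw [← hh]; exact h.left_inv hξ.1
    rw [hl]
  · intro ξ hξ; exact neg_ne_zero.2 (hne ξ hξ.2).1
  · intro ξ hξ
    obtain ⟨-, -, q1, q2, q3⟩ := hQ1 ξ hξ.2
    rw [dφ ξ hξ.2]
    simp only [map_add, map_smul, hxf ξ hξ.2.1, hxg ξ hξ.2.1, hyf ξ hξ.2.1, hyg ξ hξ.2.1,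
      hQf ξ hξ.2.1]
    ext i
    fin_cases i
    · simp [fE, φ, w, Real.cos_arcsin, q3]
    · simp [fE, φ, w, Real.sin_arcsin q1 q2]
    · simp [fE]
  · intro ξ hξ
    have hp : P ξ ≠ 0 := ne_of_gt hξ.2.2
    rw [dφ ξ hξ.2]
    simp only [map_smul, hxg ξ hξ.2.1, hyg ξ hξ.2.1, smul_eq_mul, neg_mul, hQg ξ hξ.2.1]
    ext i
    fin_cases i <;> simp [g0, hp]

lemma elliptic_backward (X : Set V3) (f g : V3 → V3)
    (hf : ContDiffOn ℝ (⊤ : ℕ∞) f X) (hg : ContDiffOn ℝ (⊤ : ℕ∞) g X) (ξ₀ : V3)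
    (H : ∃ U : Set V3, IsOpen U ∧ ξ₀ ∈ U ∧ U ⊆ X ∧
        ∃ v₁ v₂ v₃ : V3 → V3,
          ContDiffOn ℝ (⊤ : ℕ∞) v₁ U ∧ ContDiffOn ℝ (⊤ : ℕ∞) v₂ U ∧ ContDiffOn ℝ (⊤ : ℕ∞) v₃ U ∧
          SymmSpanned U f g v₁ v₂ v₃ ∧
          IndepFieldsOn U v₁ v₂ v₃ ∧
          (∀ ξ ∈ U, lieBr v₁ v₂ ξ = 0 ∧ lieBr v₁ v₃ ξ = -(v₂ ξ) ∧ lieBr v₂ v₃ ξ = v₁ ξ) ∧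
          LinearIndependent ℝ ![v₁ ξ₀, v₂ ξ₀, g ξ₀]) :
    LocFeedbackEquiv X f g ξ₀ fE g0 0 := by
  obtain ⟨U, hU, hξU, hUX, v₁, v₂, v₃, h1, h2, h3, hs, -, hbr, hLI⟩ := H
  have s1 : InfSymmOn U f g v₁ := ((hs v₁).2 ⟨1, 0, 0, by simp⟩).2
  have s2 : InfSymmOn U f g v₂ := ((hs v₂).2 ⟨0, 1, 0, by simp⟩).2
  have s3 : InfSymmOn U f g v₃ := ((hs v₃).2 ⟨0, 0, 1, by simp⟩).2
  obtain ⟨R, hR, hBU, θ₀, θ₁, θ₂, t0, t1, t2, hfr⟩ :=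
    frame_exists hU h1 h2 (hg.mono hUX) hξU hLI
  have hξB : ξ₀ ∈ Metric.ball ξ₀ R := Metric.mem_ball_self hR
  have hBo : IsOpen (Metric.ball ξ₀ R) := Metric.isOpen_ball
  have hBc : Convex ℝ (Metric.ball ξ₀ R) := convex_ball _ _
  have hBp : IsPreconnected (Metric.ball ξ₀ R) := hBc.isPreconnected
  generalize Metric.ball ξ₀ R = B at *
  have hu : ∀ ξ ∈ B, ∀ u, u = θ₀ ξ u • v₁ ξ + θ₁ ξ u • v₂ ξ + θ₂ ξ u • g ξ :=
    fun ξ hξ => (hfr ξ hξ).2.2.2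
  have hfB := hf.mono (hBU.trans hUX)
  have hgB := hg.mono (hBU.trans hUX)
  have h1B := h1.mono hBU
  have h2B := h2.mono hBU
  have h3B := h3.mono hBU
  have s1B : InfSymmOn B f g v₁ := fun ξ hξ => s1 ξ (hBU hξ)
  have s2B : InfSymmOn B f g v₂ := fun ξ hξ => s2 ξ (hBU hξ)
  have s3B : InfSymmOn B f g v₃ := fun ξ hξ => s3 ξ (hBU hξ)
  have b12 : ∀ ξ ∈ B, lieBr v₁ v₂ ξ = 0 := fun ξ hξ => (hbr ξ (hBU hξ)).1
  have b13 : ∀ ξ ∈ B, lieBr v₁ v₃ ξ = -(v₂ ξ) := fun ξ hξ => (hbr ξ (hBU hξ)).2.1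
  have b23 : ∀ ξ ∈ B, lieBr v₂ v₃ ξ = v₁ ξ := fun ξ hξ => (hbr ξ (hBU hξ)).2.2
  have e01 : ∀ ξ ∈ B, θ₀ ξ (v₁ ξ) = 1 := fun ξ hξ => (hfr ξ hξ).1.1
  have e02 : ∀ ξ ∈ B, θ₀ ξ (v₂ ξ) = 0 := fun ξ hξ => (hfr ξ hξ).1.2.1
  have e0g : ∀ ξ ∈ B, θ₀ ξ (g ξ) = 0 := fun ξ hξ => (hfr ξ hξ).1.2.2
  have e11 : ∀ ξ ∈ B, θ₁ ξ (v₁ ξ) = 0 := fun ξ hξ => (hfr ξ hξ).2.1.1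
  have e12 : ∀ ξ ∈ B, θ₁ ξ (v₂ ξ) = 1 := fun ξ hξ => (hfr ξ hξ).2.1.2.1
  have e1g : ∀ ξ ∈ B, θ₁ ξ (g ξ) = 0 := fun ξ hξ => (hfr ξ hξ).2.1.2.2
  have cl0 := form_closed hBo t0 h1B h2B hgB e01 e02 e0g hu b12
    (fun ξ hξ => (s1B ξ hξ).1) (fun ξ hξ => (s2B ξ hξ).1)
  have cl1 := form_closed hBo t1 h1B h2B hgB e11 e12 e1g hu b12
    (fun ξ hξ => (s1B ξ hξ).1) (fun ξ hξ => (s2B ξ hξ).1)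
  obtain ⟨x, x0, hx, dx⟩ := primitive_smooth hBo hBc t0 cl0 ξ₀
  obtain ⟨y, y0, hy, dy⟩ := primitive_smooth hBo hBc t1 cl1 ξ₀
  have drift0 := fun ξ (hξ : ξ ∈ B) => form_drift hBo t0 h1B h2B h3B hfB hgB e01 e02 e0g hu cl0 b13 b23
    s1B s2B s3B hξ
  have drift1 := fun ξ (hξ : ξ ∈ B) => form_drift hBo t1 h1B h2B h3B hfB hgB e11 e12 e1g hu cl1 b13 b23
    s1B s2B s3B hξ
  obtain ⟨p, hpdef⟩ : ∃ p : V3 → ℝ, p = fun ζ => θ₀ ζ (f ζ) := ⟨_, rfl⟩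
  obtain ⟨q, hqdef⟩ : ∃ q : V3 → ℝ, q = fun ζ => θ₁ ζ (f ζ) := ⟨_, rfl⟩
  have hp : ContDiffOn ℝ (⊤ : ℕ∞) p B := by rw [hpdef]; exact t0.clm_apply hfB
  have hq : ContDiffOn ℝ (⊤ : ℕ∞) q B := by rw [hqdef]; exact t1.clm_apply hfB
  have hr : ContDiffOn ℝ (⊤ : ℕ∞) (fun ζ => θ₂ ζ (f ζ)) B := t2.clm_apply hfB
  have hc : ContDiffOn ℝ (⊤ : ℕ∞) (fun ζ => θ₂ ζ (v₃ ζ)) B := t2.clm_apply h3B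
  have pe : ∀ ξ, θ₀ ξ (f ξ) = p ξ := fun ξ => by rw [hpdef]
  have qe : ∀ ξ, θ₁ ξ (f ξ) = q ξ := fun ξ => by rw [hqdef]
  rw [← hpdef] at drift0
  rw [← hqdef] at drift1
  simp only [pe, qe, mul_one, mul_zero, sub_zero, zero_sub] at drift0 drift1
  -- every derivative of p, q is a multiple of that along g
  have dpu : ∀ ξ ∈ B, ∀ u, fderiv ℝ p ξ u = θ₂ ξ u * fderiv ℝ p ξ (g ξ) := by
    intro ξ hξ u
    conv_lhs => rw [hu ξ hξ u]
    simp [(drift0 ξ hξ).1, (drift0 ξ hξ).2.1]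
  have dqu : ∀ ξ ∈ B, ∀ u, fderiv ℝ q ξ u = θ₂ ξ u * fderiv ℝ q ξ (g ξ) := by
    intro ξ hξ u
    conv_lhs => rw [hu ξ hξ u]
    simp [(drift1 ξ hξ).1, (drift1 ξ hξ).2.1]
  have hρd : ∀ ξ ∈ B, HasFDerivAt (fun ζ => p ζ ^ 2 + q ζ ^ 2) (0 : V3 →L[ℝ] ℝ) ξ := by
    intro ξ hξ
    have h := ((smoothOn_diffAt hBo hp hξ).hasFDerivAt.pow 2).add
      ((smoothOn_diffAt hBo hq hξ).hasFDerivAt.pow 2)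
    convert! h using 1
    ext u
    obtain ⟨-, -, z0⟩ := drift0 ξ hξ
    obtain ⟨-, -, z1⟩ := drift1 ξ hξ
    simp only [zero_apply, add_apply, smul_apply, smul_eq_mul, dpu ξ hξ u, dqu ξ hξ u]
    have key : p ξ * fderiv ℝ p ξ (g ξ) + q ξ * fderiv ℝ q ξ (g ξ) = 0 := by
      by_cases hc0 : θ₂ ξ (v₃ ξ) = 0
      · rw [hc0] at z0 z1
        have a : q ξ = 0 := by linarith
        have b : p ξ = 0 := by linarith
        rw [a, b]; ring
      · apply mul_left_cancel₀ hc0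
        linear_combination p ξ * z0 + q ξ * z1
    push_cast
    simp only [Nat.add_one_sub_one, pow_one, nsmul_eq_mul, Nat.cast_ofNat]
    linear_combination (-2) * θ₂ ξ u * key
  obtain ⟨ρ, hρ⟩ : ∃ ρ : ℝ, ∀ ξ ∈ B, p ξ ^ 2 + q ξ ^ 2 = ρ :=
    ⟨p ξ₀ ^ 2 + q ξ₀ ^ 2, fun ξ hξ => hBo.is_const_of_fderiv_eq_zero (𝕜 := ℝ) hBp
      (fun ζ hζ => (hρd ζ hζ).differentiableAt.differentiableWithinAt)
      (fun ζ hζ => (hρd ζ hζ).fderiv) hξ hξB⟩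
  have hρ0 : ρ ≠ 0 := by
    intro hz
    refine drift_not_parallel hU hBo hBU hξB (hg.mono hUX) h1 h2 h3 hr ?_ hs s1 hbr hLI
    intro ξ hξ
    have h := hρ ξ hξ
    rw [hz] at h
    have a : p ξ = 0 := by nlinarith [sq_nonneg (p ξ), sq_nonneg (q ξ)]
    have b : q ξ = 0 := by nlinarith [sq_nonneg (p ξ), sq_nonneg (q ξ)]
    conv_lhs => rw [hu ξ hξ (f ξ)]
    simp [pe, qe, a, b]
  have hρξ := hρ ξ₀ hξB
  obtain ⟨a, ha⟩ : ∃ a : ℝ, a = p ξ₀ / ρ := ⟨_, rfl⟩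
  obtain ⟨b, hb⟩ : ∃ b : ℝ, b = q ξ₀ / ρ := ⟨_, rfl⟩
  have n1 : a * p ξ₀ + b * q ξ₀ = 1 := by
    rw [ha, hb]; field_simp; linarith
  have n2 : -b * p ξ₀ + a * q ξ₀ = 0 := by
    rw [ha, hb]; field_simp; ring
  have n3 : (a ^ 2 + b ^ 2) * ρ = 1 := by
    rw [ha, hb]; field_simp; linarith
  have comb : ∀ {F G : V3 → ℝ} (s t : ℝ), ContDiffOn ℝ (⊤ : ℕ∞) F B → ContDiffOn ℝ (⊤ : ℕ∞) G B →
      ContDiffOn ℝ (⊤ : ℕ∞) (fun ξ => s * F ξ + t * G ξ) B := fun s t hF hG =>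
    (contDiffOn_const.mul hF).add (contDiffOn_const.mul hG)
  have dcomb : ∀ {F G : V3 → ℝ} (s t : ℝ) (ξ u : V3), DifferentiableAt ℝ F ξ →
      DifferentiableAt ℝ G ξ → fderiv ℝ (fun ξ => s * F ξ + t * G ξ) ξ u =
        s * fderiv ℝ F ξ u + t * fderiv ℝ G ξ u := by
    intro F G s t ξ u hF hG
    have h := ((hF.hasFDerivAt.const_mul s).fun_add (hG.hasFDerivAt.const_mul t)).fderiv
    rw [h]; simp
  have dxy : ∀ (s t : ℝ), ∀ ξ ∈ B, ∀ u, fderiv ℝ (fun ξ => s * x ξ + t * y ξ) ξ u =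
      s * θ₀ ξ u + t * θ₁ ξ u := by
    intro s t ξ hξ u
    rw [dcomb s t ξ u (dx ξ hξ).differentiableAt (dy ξ hξ).differentiableAt,
      (dx ξ hξ).fderiv, (dy ξ hξ).fderiv]
  have dpq : ∀ ξ ∈ B, ∀ u, fderiv ℝ (fun ξ => -b * p ξ + a * q ξ) ξ u =
      -b * fderiv ℝ p ξ u + a * fderiv ℝ q ξ u := fun ξ hξ u =>
    dcomb (-b) a ξ u (smoothOn_diffAt hBo hp hξ) (smoothOn_diffAt hBo hq hξ)
  refine chart_final hBo (hBU.trans hUX) (x := fun ξ => a * x ξ + b * y ξ)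
    (y := fun ξ => -b * x ξ + a * y ξ) (P := fun ξ => a * p ξ + b * q ξ)
    (Q := fun ξ => -b * p ξ + a * q ξ) hξB (comb a b hx hy) (comb (-b) a hx hy)
    (comb a b hp hq) (comb (-b) a hp hq) hc hr (by simp [x0, y0]) (by simp [x0, y0]) n1 n2
    ?_ ?_ ?_ ?_ ?_ ?_ ?_ ?_
  · intro ξ hξ
    linear_combination (a ^ 2 + b ^ 2) * hρ ξ hξ + n3
  · intro ξ hξ; rw [dxy a b ξ hξ, pe, qe]
  · intro ξ hξ; rw [dxy a b ξ hξ, e0g ξ hξ, e1g ξ hξ]; ring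
  · intro ξ hξ; rw [dxy (-b) a ξ hξ, pe, qe]
  · intro ξ hξ; rw [dxy (-b) a ξ hξ, e0g ξ hξ, e1g ξ hξ]; ring
  · intro ξ hξ
    rw [dpq ξ hξ, dpq ξ hξ, dpu ξ hξ (f ξ), dqu ξ hξ (f ξ)]; ring
  · intro ξ hξ
    rw [dpq ξ hξ]
    linear_combination (-b) * (drift0 ξ hξ).2.2 + a * (drift1 ξ hξ).2.2
  · intro ξ hξ u hu1 hu2
    rw [dxy _ _ ξ hξ] at hu1 hu2
    have z0 : θ₀ ξ u = 0 := by
      linear_combination (a * ρ) * hu1 - (b * ρ) * hu2 - θ₀ ξ u * n3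
    have z1 : θ₁ ξ u = 0 := by
      linear_combination (b * ρ) * hu1 + (a * ρ) * hu2 - θ₁ ξ u * n3
    refine ⟨θ₂ ξ u, ?_⟩
    conv_lhs => rw [hu ξ hξ u]
    simp [z0, z1]

/-- a control-affine system (f,g) is locally feedback equivalent at ξ₀ to
the elliptic system Σ_E at the origin iff on some neighbourhood U of ξ₀ its Lie algebra
of infinitesimal symmetries is exactly the span of smooth, linearly independent fields
v₁, v₂, v₃ satisfying the 𝔏_E bracket relations [v₁,v₂]=0, [v₁,v₃]=−v₂, [v₂,v₃]=v₁,
and v₁(ξ₀), v₂(ξ₀), g(ξ₀) are linearly independent. -/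
theorem elliptic_characterised_by_symmetries
    (X : Set V3) (hX : IsOpen X) (f g : V3 → V3)
    (hf : ContDiffOn ℝ (⊤ : ℕ∞) f X) (hg : ContDiffOn ℝ (⊤ : ℕ∞) g X)
    (hgne : ∀ ξ ∈ X, g ξ ≠ 0) (ξ₀ : V3) (hξ₀ : ξ₀ ∈ X) :
    LocFeedbackEquiv X f g ξ₀ fE g0 0 ↔
      ∃ U : Set V3, IsOpen U ∧ ξ₀ ∈ U ∧ U ⊆ X ∧
        ∃ v₁ v₂ v₃ : V3 → V3,
          ContDiffOn ℝ (⊤ : ℕ∞) v₁ U ∧ ContDiffOn ℝ (⊤ : ℕ∞) v₂ U ∧ ContDiffOn ℝ (⊤ : ℕ∞) v₃ U ∧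
          SymmSpanned U f g v₁ v₂ v₃ ∧
          IndepFieldsOn U v₁ v₂ v₃ ∧
          (∀ ξ ∈ U, lieBr v₁ v₂ ξ = 0 ∧ lieBr v₁ v₃ ξ = -(v₂ ξ) ∧ lieBr v₂ v₃ ξ = v₁ ξ) ∧
          LinearIndependent ℝ ![v₁ ξ₀, v₂ ξ₀, g ξ₀] := by
  exact ⟨elliptic_forward X f g hf hg ξ₀, elliptic_backward X f g hf hg ξ₀⟩
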